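/- Let ν, λ, C₀ > 0 and set A₀ := min{ν/(2C₀), λ/C₀}. Suppose x, y : [0, ∞) → [0, ∞) are continuously differentiable and satisfy x'(t) + ν x(t) ≤ C₀ x(t)² + C₀ y(t) and y'(t) + λ y(t) ≤ C₀ x(t) y(t) for all t ≥ 0, with x(0) < A₀ and y(0) < (ν/(2C₀)) A₀. Then for all t ≥ 0, x(t) < A₀ and y(t) ≤ y(0). -/

import Mathlib

open Set

/-- If `f` is continuous on `[a, ∞)`, starts below `c` and is not below `c` at `b ≥ a`, there is a
first time at which it equals `c`. -/
theorem exists_first_hitting_time {f : ℝ → ℝ} {a b c : ℝ} (hf : ContinuousOn f (Ici a))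
    (ha : f a < c) (hab : a ≤ b) (hb : c ≤ f b) :
    ∃ T, a < T ∧ f T = c ∧ ∀ s ∈ Ico a T, f s < c := by
  have hcl : IsClosed (Icc a b ∩ f ⁻¹' Ici c) :=
    (hf.mono Icc_subset_Ici_self).preimage_isClosed_of_isClosed isClosed_Icc isClosed_Ici
  obtain ⟨T, ⟨⟨haT, hTb⟩, hcT⟩, hT⟩ :=
    (isCompact_Icc.of_isClosed_subset hcl inter_subset_left).exists_isLeast
      ⟨b, right_mem_Icc.2 hab, hb⟩
  have hlt : ∀ s ∈ Ico a T, f s < c := fun s hs => by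
    by_contra! h
    exact absurd (hT ⟨⟨hs.1, hs.2.le.trans hTb⟩, h⟩) (not_le.2 hs.2)
  have haT' : a < T := lt_of_le_of_ne haT fun h => absurd hcT (not_le.2 (h ▸ ha))
  refine ⟨T, haT', le_antisymm ?_ hcT, hlt⟩
  have hcont : ContinuousAt f T := hf.continuousAt (Ici_mem_nhds haT')
  refine le_of_tendsto (hcont.tendsto.mono_left (nhdsWithin_le_nhds (s := Iio T))) ?_
  filter_upwards [Ioo_mem_nhdsLT haT'] with s hs
  exact (hlt s ⟨hs.1.le, hs.2⟩).le

/-- The derivative is nonnegative at a point where `f` is at least all its values just before. -/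
theorem HasDerivAt.nonneg_of_forall_Ico_le {f : ℝ → ℝ} {f' a T : ℝ} (hf : HasDerivAt f f' T)
    (haT : a < T) (h : ∀ s ∈ Ico a T, f s ≤ f T) : 0 ≤ f' := by
  have hs := (hasDerivWithinAt_iff_tendsto_slope' self_notMem_Iio).1
    (hf.hasDerivWithinAt (s := Iio T))
  refine ge_of_tendsto hs ?_
  filter_upwards [Ioo_mem_nhdsLT haT] with s hs
  rw [slope_def_field]
  exact div_nonneg_of_nonpos (sub_nonpos.2 (h s ⟨hs.1.le, hs.2⟩)) (sub_nonpos.2 hs.2.le)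

/-- **Differential-inequality bootstrap lemma** used to propagate smallness for the damped 2D
Boussinesq system. Let `ν, λ, C₀ > 0` and `A₀ = min{ν/(2C₀), λ/C₀}`. If `x, y : [0,∞) → [0,∞)`
are continuously differentiable and satisfy `x' + ν x ≤ C₀ x² + C₀ y` and `y' + λ y ≤ C₀ x y`
on `[0,∞)`, with `x 0 < A₀` and `y 0 < (ν/(2C₀)) A₀`, then `x t < A₀` and `y t ≤ y 0` for all
`t ≥ 0`. -/
theorem bootstrap_smallness (ν lam C₀ A₀ : ℝ) (hν : 0 < ν) (hlam : 0 < lam) (hC₀ : 0 < C₀)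
    (hA₀ : A₀ = min (ν / (2 * C₀)) (lam / C₀))
    (x y x' y' : ℝ → ℝ)
    (hxnn : ∀ t ∈ Ici (0:ℝ), 0 ≤ x t) (hynn : ∀ t ∈ Ici (0:ℝ), 0 ≤ y t)
    (hx : ∀ t ∈ Ici (0:ℝ), HasDerivWithinAt x (x' t) (Ici 0) t)
    (hy : ∀ t ∈ Ici (0:ℝ), HasDerivWithinAt y (y' t) (Ici 0) t)
    (hx' : ContinuousOn x' (Ici 0)) (hy' : ContinuousOn y' (Ici 0))
    (h1 : ∀ t ∈ Ici (0:ℝ), x' t + ν * x t ≤ C₀ * x t ^ 2 + C₀ * y t)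
    (h2 : ∀ t ∈ Ici (0:ℝ), y' t + lam * y t ≤ C₀ * x t * y t)
    (hx0 : x 0 < A₀) (hy0 : y 0 < ν / (2 * C₀) * A₀) :
    ∀ t ∈ Ici (0:ℝ), x t < A₀ ∧ y t ≤ y 0 := by
  have hxA : C₀ * A₀ ≤ ν / 2 := by
    have h : A₀ ≤ ν / (2 * C₀) := hA₀ ▸ min_le_left _ _
    rw [le_div_iff₀ (by positivity)] at h
    linarith
  have hyA : C₀ * A₀ ≤ lam := by
    have h : A₀ ≤ lam / C₀ := hA₀ ▸ min_le_right _ _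
    rw [le_div_iff₀ hC₀] at h
    linarith
  have hA₀pos : 0 < A₀ := (hxnn 0 self_mem_Ici).trans_lt hx0
  have hy_le : ∀ T, 0 ≤ T → (∀ s ∈ Ico 0 T, x s < A₀) → y T ≤ y 0 := by
    intro T hT hlt
    have hanti : AntitoneOn y (Icc 0 T) := by
      refine antitoneOn_of_hasDerivWithinAt_nonpos (f' := y') (convex_Icc 0 T)
        (fun s hs => (hy s hs.1).continuousWithinAt.mono Icc_subset_Ici_self) ?_ ?_
      · rw [interior_Icc]
        exact fun s hs => (hy s hs.1.le).mono fun u hu => hu.1.le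
      · rw [interior_Icc]
        intro s hs
        have hxs : C₀ * x s ≤ lam :=
          (mul_le_mul_of_nonneg_left (hlt s ⟨hs.1.le, hs.2⟩).le hC₀.le).trans hyA
        linarith [h2 s hs.1.le, mul_le_mul_of_nonneg_right hxs (hynn s hs.1.le)]
    exact hanti (left_mem_Icc.2 hT) (right_mem_Icc.2 hT) hT
  have hx_lt : ∀ t ∈ Ici (0:ℝ), x t < A₀ := by
    intro t ht
    by_contra! hxt
    obtain ⟨T, hT, hxT, hlt⟩ := exists_first_hitting_time
      (fun s hs => (hx s hs).continuousWithinAt) hx0 ht hxt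
    have hderiv : 0 ≤ x' T := ((hx T hT.le).hasDerivAt (Ici_mem_nhds hT)).nonneg_of_forall_Ico_le
      hT fun s hs => hxT ▸ (hlt s hs).le
    have hyT : C₀ * y T < ν / 2 * A₀ := by
      calc C₀ * y T < C₀ * (ν / (2 * C₀) * A₀) :=
            mul_lt_mul_of_pos_left ((hy_le T hT.le hlt).trans_lt hy0) hC₀
        _ = ν / 2 * A₀ := by field_simp
    have h := h1 T hT.le
    rw [hxT] at h
    nlinarith [mul_le_mul_of_nonneg_right hxA hA₀pos.le]
  exact fun t ht => ⟨hx_lt t ht, hy_le t ht fun s hs => hx_lt s hs.1⟩
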